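/- Let β > 1 be a quadratic unit (β² = pβ + 1 with integer p ≥ 1, or β² = pβ − 1 with integer p ≥ 3), let m ∈ ℕ with m ≥ ⌊β⌋, and let Ω = ( −mβ/(β² − 1), mβ²/(β² − 1) ) in the first case and Ω = [ 0, mβ/(β − 1) ) in the second case. Then for every δ ∈ (0,1) there exists K > 0 such that [K, ∞) ∩ Σ_β((1−δ)Ω) ⊆ X^m(β) ⊆ Σ_β(Ω), where (1−δ)Ω = { (1−δ)x : x ∈ Ω }. -/

import Mathlib

/-- The spectrum `X^m(β)`: sums `∑_{j=0}^n a_j β^j` with digits `a_j ∈ {0,1,…,m}`. -/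
def Xspec (β : ℝ) (m : ℕ) : Set ℝ :=
  {x | ∃ (n : ℕ) (c : ℕ → ℕ), (∀ j ≤ n, c j ≤ m) ∧
    x = ∑ j ∈ Finset.range (n + 1), (c j : ℝ) * β ^ j}

/-- The cut-and-project set `Σ_β(Ω) = { x ∈ ℤ + ℤβ : x′ ∈ Ω }`, where `x′ = a + bβ′`
for `x = a + bβ`. -/
def sigmaCP (β β' : ℝ) (Ω : Set ℝ) : Set ℝ :=
  {x | ∃ a b : ℤ, x = (a : ℝ) + (b : ℝ) * β ∧ (a : ℝ) + (b : ℝ) * β' ∈ Ω}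

theorem intCast_mem_Xspec (β : ℝ) {m : ℕ} {c : ℤ} (hc0 : 0 ≤ c) (hcm : c ≤ m) :
    (c : ℝ) ∈ Xspec β m := by
  lift c to ℕ using hc0
  exact ⟨0, fun _ => c, fun _ _ => by exact_mod_cast hcm, by simp⟩

theorem intCast_add_mul_mem_Xspec {β : ℝ} {m : ℕ} {c : ℤ} {x : ℝ} (hc0 : 0 ≤ c) (hcm : c ≤ m)
    (hx : x ∈ Xspec β m) : (c : ℝ) + β * x ∈ Xspec β m := by
  lift c to ℕ using hc0
  obtain ⟨n, d, hd, rfl⟩ := hx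
  refine ⟨n + 1, fun j => Nat.casesOn j c d, ?_, ?_⟩
  · rintro (_ | j) hj
    · exact_mod_cast hcm
    · exact hd j (by omega)
  · rw [Finset.sum_range_succ' _ (n + 1), Finset.mul_sum, add_comm]
    simp only [pow_zero, mul_one, Int.cast_natCast]
    congr 1
    refine Finset.sum_congr rfl fun j _ => ?_
    ring

theorem Xspec_induction {β : ℝ} {m : ℕ} {P : ℝ → Prop}
    (digit : ∀ c : ℕ, c ≤ m → P c)
    (step : ∀ (c : ℕ) (x : ℝ), c ≤ m → P x → P (c + β * x)) {x : ℝ} (hx : x ∈ Xspec β m) :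
    P x := by
  obtain ⟨n, d, hd, rfl⟩ := hx
  induction n generalizing d with
  | zero => simpa using digit (d 0) (hd 0 le_rfl)
  | succ n ih =>
    have h := step (d 0) _ (hd 0 (by omega)) (ih (fun j => d (j + 1)) fun j hj => hd _ (by omega))
    convert h using 1
    rw [Finset.sum_range_succ' _ (n + 1), Finset.mul_sum, add_comm]
    simp only [pow_zero, mul_one]
    congr 1
    refine Finset.sum_congr rfl fun j _ => ?_
    ring

/-- A window that contains the digits and is stable under `y ↦ c + β' y` for every digit `c`
captures the conjugates of the whole spectrum. -/
theorem Xspec_subset_sigmaCP {β β' : ℝ} {p e : ℤ} {m : ℕ} {Ω : Set ℝ}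
    (hβ : β ^ 2 = p * β + e) (hconj : β' ^ 2 = p * β' + e)
    (digit : ∀ c : ℕ, c ≤ m → (c : ℝ) ∈ Ω)
    (step : ∀ c : ℕ, c ≤ m → ∀ y ∈ Ω, c + β' * y ∈ Ω) :
    Xspec β m ⊆ sigmaCP β β' Ω := by
  intro x hx
  refine Xspec_induction (P := (· ∈ sigmaCP β β' Ω)) ?_ ?_ hx
  · exact fun c hc => ⟨c, 0, by simp, by simpa using digit c hc⟩
  · rintro c _ hc ⟨a, b, rfl, hab⟩
    refine ⟨c + b * e, a + b * p, ?_, ?_⟩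
    · push_cast
      linear_combination (b : ℝ) * hβ
    · convert step c hc _ hab using 1
      push_cast
      linear_combination -(b : ℝ) * hconj

/-- Lower bounds on the `β`-coordinate of `x` follow from lower bounds on `x` when the conjugate
of `x` is bounded. -/
theorem Ici_inter_sigmaCP_subset_Xspec {β β' M N : ℝ} {m : ℕ} {Ω : Set ℝ} (hββ' : β' < β)
    (hΩ : ∀ y ∈ Ω, y ≤ M)
    (h : ∀ a b : ℤ, N ≤ b → (a : ℝ) + b * β' ∈ Ω → (a : ℝ) + b * β ∈ Xspec β m) :
    ∃ K : ℝ, 0 < K ∧ Set.Ici K ∩ sigmaCP β β' Ω ⊆ Xspec β m := by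
  refine ⟨max 1 (N * (β - β') + M), by positivity, ?_⟩
  rintro _ ⟨hK, a, b, rfl, hab⟩
  refine h a b ?_ hab
  have h1 : N * (β - β') + M ≤ a + b * β := (le_max_right _ _).trans hK
  have h2 := hΩ _ hab
  have h3 : N * (β - β') ≤ b * (β - β') := by linarith
  exact le_of_mul_le_mul_right h3 (by linarith)

section NegativeNorm

variable {β q : ℝ} {p : ℤ} {m : ℕ}

theorem add_mul_mem_Xspec_of_step_neg (hβp : β = p + q) (hqβ : q * β = 1) {a b c : ℤ}
    (hc0 : 0 ≤ c) (hcm : c ≤ m)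
    (h : ((b - p * (a - c) : ℤ) : ℝ) + ((a - c : ℤ) : ℝ) * β ∈ Xspec β m) :
    (a : ℝ) + b * β ∈ Xspec β m := by
  convert intCast_add_mul_mem_Xspec hc0 hcm h using 1
  push_cast
  linear_combination (c - a : ℝ) * hqβ + (a - c : ℝ) * (-β) * hβp

theorem conj_step_neg (hβp : β = p + q) (hqβ : q * β = 1) (a b c : ℤ) :
    ((b - p * (a - c) : ℤ) : ℝ) - ((a - c : ℤ) : ℝ) * q = β * (c - (a - b * q)) := by
  push_cast
  linear_combination (a - c : ℝ) * hβp - (b : ℝ) * hqβ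

theorem mem_Xspec_of_conj_neg (hp : 1 ≤ p) (hβp : β = p + q) (hqβ : q * β = 1) (hq0 : 0 < q)
    (hq1 : q < 1) (hm : p ≤ m) (a b : ℤ) (hb : 0 ≤ b) (h1 : -1 < a - b * q)
    (h2 : a - b * q < m + q) : (a : ℝ) + b * β ∈ Xspec β m := by
  have hmR : (p : ℝ) ≤ m := by exact_mod_cast hm
  have hpR : (1 : ℝ) ≤ p := by exact_mod_cast hp
  induction hn : (a + 2 * b).toNat using Nat.strong_induction_on generalizing a b with
  | _ n ih =>
  have hbR : (0 : ℝ) ≤ b := by exact_mod_cast hb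
  have ha : 0 ≤ a := by
    have : (-1 : ℝ) < a := by nlinarith
    have : -1 < a := by exact_mod_cast this
    omega
  rcases hb.eq_or_lt with rfl | hbpos
  · have : (a : ℝ) < m + 1 := by push_cast at h2; linarith
    have : a < m + 1 := by exact_mod_cast this
    simpa using intCast_mem_Xspec β ha (by omega)
  obtain ⟨c, hc0, hcm, hc1, hc2⟩ : ∃ c : ℤ, 0 ≤ c ∧ c ≤ m ∧
      (c : ℝ) - 1 < a - b * q ∧ a - b * q < c + q := by
    rcases le_total (a - b * q : ℝ) m with h | h
    · refine ⟨⌈(a - b * q : ℝ)⌉, ?_, Int.ceil_le.2 (by exact_mod_cast h), ?_, ?_⟩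
      · have : -1 < ⌈(a - b * q : ℝ)⌉ := Int.lt_ceil.2 (by exact_mod_cast h1)
        omega
      · linarith [Int.ceil_lt_add_one (a - b * q : ℝ)]
      · linarith [Int.le_ceil (a - b * q : ℝ)]
    · exact ⟨m, by omega, le_rfl, by push_cast; linarith, by exact_mod_cast h2⟩
  have hb1 : 0 ≤ a - c := by
    have : (-1 : ℝ) < ((a - c : ℤ) : ℝ) := by push_cast; nlinarith
    have : -1 < a - c := by exact_mod_cast this
    omega
  have hβ : 0 < β := by linarith
  refine add_mul_mem_Xspec_of_step_neg hβp hqβ hc0 hcm (ih _ ?_ _ _ hb1 ?_ ?_ rfl)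
  · have : a - c ≤ p * (a - c) := le_mul_of_one_le_left hb1 hp
    omega
  · rw [conj_step_neg hβp hqβ]
    nlinarith
  · rw [conj_step_neg hβp hqβ]
    nlinarith

theorem exists_forall_mem_Xspec_neg {A : ℝ} (hp : 1 ≤ p) (hβp : β = p + q) (hqβ : q * β = 1)
    (hq0 : 0 < q) (hq1 : q < 1) (hm : p ≤ m) (hA : 0 < A) (hAm : β * A = m + q * A) (k : ℕ) :
    ∃ N : ℝ, 0 ≤ N ∧ ∀ a b : ℤ, N ≤ b → A < β ^ k * (a - b * q + A) →
      A < β ^ k * (β * A - (a - b * q)) → (a : ℝ) + b * β ∈ Xspec β m := by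
  have hpR : (1 : ℝ) ≤ p := by exact_mod_cast hp
  have hβ1 : 1 < β := by linarith
  have hβk (k : ℕ) : 1 ≤ β ^ k := one_le_pow₀ hβ1.le
  have hm0 : (0 : ℝ) ≤ m := by positivity
  induction k with
  | zero =>
    refine ⟨0, le_rfl, fun a b hb h1 h2 =>
      mem_Xspec_of_conj_neg hp hβp hqβ hq0 hq1 hm a b (by exact_mod_cast hb) ?_ ?_⟩
    · linarith
    · nlinarith
  | succ k ih =>
    obtain ⟨N, hN, ih⟩ := ih
    refine ⟨β * (N + A + m), by positivity, fun a b hb h1 h2 => ?_⟩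
    have hb0 : (0 : ℝ) ≤ b := le_trans (by positivity) hb
    have hbq : N + A + m ≤ b * q := by
      have := mul_le_mul_of_nonneg_right hb hq0.le
      linear_combination this - (N + A + m) * hqβ
    rw [pow_succ, mul_assoc] at h1 h2
    have hpos : 0 < a - b * q + A := by
      have : 0 < β ^ k * (β * (a - b * q + A)) := hA.trans h1
      exact pos_of_mul_pos_right (pos_of_mul_pos_right this (by positivity)) (by positivity)
    rcases le_or_gt (a - b * q : ℝ) (-1) with h | h
    · refine add_mul_mem_Xspec_of_step_neg hβp hqβ le_rfl (by omega) (ih _ _ ?_ ?_ ?_)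
      · push_cast; linarith
      · rw [conj_step_neg hβp hqβ]
        push_cast
        have : A < β * (0 - (a - b * q)) + A := by nlinarith
        exact this.trans_le (le_mul_of_one_le_left (by linarith) (hβk k))
      · rw [conj_step_neg hβp hqβ]
        convert h1 using 2
        push_cast; ring
    rcases lt_or_ge (a - b * q : ℝ) (m + q) with h' | h'
    · exact mem_Xspec_of_conj_neg hp hβp hqβ hq0 hq1 hm a b (by exact_mod_cast hb0) h h'
    · refine add_mul_mem_Xspec_of_step_neg (c := m) hβp hqβ (by omega) le_rfl (ih _ _ ?_ ?_ ?_)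
      · push_cast; linarith
      · rw [conj_step_neg hβp hqβ]
        convert h2 using 2
        push_cast
        linear_combination -β * hAm - A * hqβ
      · rw [conj_step_neg hβp hqβ]
        push_cast
        have : A < β * A - β * (m - (a - b * q)) := by nlinarith
        exact this.trans_le (le_mul_of_one_le_left (by linarith) (hβk k))

end NegativeNorm

section PositiveNorm

variable {β q : ℝ} {p : ℤ} {m : ℕ}

theorem add_mul_mem_Xspec_of_step_pos (hβp : β = p - q) (hqβ : q * β = 1) {a b c : ℤ}
    (hc0 : 0 ≤ c) (hcm : c ≤ m)
    (h : ((b - p * (c - a) : ℤ) : ℝ) + ((c - a : ℤ) : ℝ) * β ∈ Xspec β m) :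
    (a : ℝ) + b * β ∈ Xspec β m := by
  convert intCast_add_mul_mem_Xspec hc0 hcm h using 1
  push_cast
  linear_combination (c - a : ℝ) * hqβ - (c - a : ℝ) * β * hβp

theorem conj_step_pos (hβp : β = p - q) (hqβ : q * β = 1) (a b c : ℤ) :
    ((b - p * (c - a) : ℤ) : ℝ) + ((c - a : ℤ) : ℝ) * q = β * (a + b * q - c) := by
  push_cast
  linear_combination (c - a : ℝ) * hβp - (b : ℝ) * hqβ

theorem mem_Xspec_of_conj_pos (hβp : β = p - q) (hqβ : q * β = 1) (hq0 : 0 < q)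
    (hq1 : q < 1) (hβm : β < m + 1) (a b : ℤ) (hb : 0 ≤ b) (h1 : 0 ≤ a + b * q)
    (h2 : a + b * q < m + 1) : (a : ℝ) + b * β ∈ Xspec β m := by
  have hβ : 0 < β := pos_of_mul_pos_right (by rw [hqβ]; exact one_pos) hq0.le
  induction hn : b.toNat using Nat.strong_induction_on generalizing a b with
  | _ n ih =>
  have hbR : (0 : ℝ) ≤ b := by exact_mod_cast hb
  rcases hb.eq_or_lt with rfl | hbpos
  · have h1 : 0 ≤ a := by simpa using h1
    have h2 : a < m + 1 := by
      have : (a : ℝ) < m + 1 := by simpa using h2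
      exact_mod_cast this
    simpa using intCast_mem_Xspec β h1 (by omega)
  have hbR' : (0 : ℝ) < b := by exact_mod_cast hbpos
  set c := ⌊(a + b * q : ℝ)⌋
  have hc0 : 0 ≤ c := Int.floor_nonneg.2 h1
  have hcm : c ≤ m := by
    have : c < m + 1 := Int.floor_lt.2 (by push_cast; exact h2)
    omega
  have hc1 : (c : ℝ) ≤ a + b * q := Int.floor_le _
  have hc2 : (a + b * q : ℝ) < c + 1 := Int.lt_floor_add_one _
  have hb1 : 0 ≤ c - a := by
    have : (-1 : ℝ) < ((c - a : ℤ) : ℝ) := by push_cast; nlinarith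
    have : -1 < c - a := by exact_mod_cast this
    omega
  have hb2 : c - a < b := by
    have : ((c - a : ℤ) : ℝ) < b := by push_cast; nlinarith
    exact_mod_cast this
  refine add_mul_mem_Xspec_of_step_pos hβp hqβ hc0 hcm (ih _ ?_ _ _ hb1 ?_ ?_ rfl)
  · omega
  · rw [conj_step_pos hβp hqβ]
    exact mul_nonneg hβ.le (by linarith)
  · rw [conj_step_pos hβp hqβ]
    nlinarith

theorem exists_forall_mem_Xspec_pos {L : ℝ} (hβp : β = p - q) (hqβ : q * β = 1) (hq0 : 0 < q)
    (hq1 : q < 1) (hβm : β < m + 1) (hL : 0 < L) (hLm : β * L = β * m + L) (k : ℕ) :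
    ∃ N : ℝ, 0 ≤ N ∧ ∀ a b : ℤ, N ≤ b → 0 ≤ a + b * q →
      L ≤ β ^ k * (L - (a + b * q)) → (a : ℝ) + b * β ∈ Xspec β m := by
  have hβ : 0 < β := pos_of_mul_pos_right (by rw [hqβ]; exact one_pos) hq0.le
  induction k with
  | zero =>
    refine ⟨0, le_rfl, fun a b hb h1 h2 =>
      mem_Xspec_of_conj_pos hβp hqβ hq0 hq1 hβm a b (by exact_mod_cast hb) h1 ?_⟩
    linarith
  | succ k ih =>
    obtain ⟨N, hN, ih⟩ := ih
    refine ⟨β * (N + L), by positivity, fun a b hb h1 h2 => ?_⟩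
    have hb0 : (0 : ℝ) ≤ b := le_trans (by positivity) hb
    have hbq : N + L ≤ b * q := by
      have := mul_le_mul_of_nonneg_right hb hq0.le
      linear_combination this - (N + L) * hqβ
    have hpos : 0 < L - (a + b * q) :=
      pos_of_mul_pos_right (hL.trans_le h2) (by positivity)
    rcases lt_or_ge (a + b * q : ℝ) (m + 1) with h | h
    · exact mem_Xspec_of_conj_pos hβp hqβ hq0 hq1 hβm a b (by exact_mod_cast hb0) h1 h
    · refine add_mul_mem_Xspec_of_step_pos (c := m) hβp hqβ (by omega) le_rfl (ih _ _ ?_ ?_ ?_)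
      · push_cast
        have : (0 : ℝ) ≤ m := by positivity
        linarith
      · rw [conj_step_pos hβp hqβ]
        push_cast
        exact mul_nonneg hβ.le (by linarith)
      · rw [conj_step_pos hβp hqβ]
        convert h2 using 1
        rw [pow_succ]
        push_cast
        linear_combination -β ^ k * hLm

end PositiveNorm

/-- Proposition: for every `δ ∈ (0,1)` there exists `K > 0` such that
`[K,∞) ∩ Σ_β((1-δ)Ω) ⊆ X^m(β) ⊆ Σ_β(Ω)`. -/
theorem spectrum_squeezed_by_cutProject (β : ℝ) (p : ℤ) (m : ℕ) (Ω : Set ℝ)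
    (hβ : 1 < β)
    (hcase :
      (1 ≤ p ∧ β ^ 2 = p * β + 1 ∧
        Ω = Set.Ioo (-((m : ℝ) * β) / (β ^ 2 - 1)) ((m : ℝ) * β ^ 2 / (β ^ 2 - 1))) ∨
      (3 ≤ p ∧ β ^ 2 = p * β - 1 ∧
        Ω = Set.Ico (0 : ℝ) ((m : ℝ) * β / (β - 1))))
    (hm : ⌊β⌋ ≤ (m : ℤ))
    (δ : ℝ) (hδ0 : 0 < δ) (hδ1 : δ < 1) :
    ∃ K : ℝ, 0 < K ∧
      Set.Ici K ∩ sigmaCP β ((p : ℝ) - β) ((fun x => (1 - δ) * x) '' Ω) ⊆ Xspec β m ∧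
      Xspec β m ⊆ sigmaCP β ((p : ℝ) - β) Ω := by
  have hβ0 : 0 < β := by linarith
  obtain ⟨q, hqβ⟩ : ∃ q, q * β = 1 := ⟨β⁻¹, inv_mul_cancel₀ hβ0.ne'⟩
  have hq0 : 0 < q := pos_of_mul_pos_left (by rw [hqβ]; exact one_pos) hβ0.le
  have hq1 : q < 1 := by nlinarith
  have hm1 : (1 : ℝ) ≤ m := by
    have : (1 : ℤ) ≤ m := (Int.le_floor.2 (by exact_mod_cast hβ.le)).trans hm
    exact_mod_cast this
  have hβm : β < m + 1 := by
    have : (⌊β⌋ : ℝ) ≤ m := by exact_mod_cast hm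
    linarith [Int.lt_floor_add_one β]
  obtain ⟨k, hk⟩ := pow_unbounded_of_one_lt δ⁻¹ hβ
  have hk : 1 < β ^ k * δ := (inv_lt_iff_one_lt_mul₀ hδ0).1 hk
  rcases hcase with ⟨hp, hβ2, rfl⟩ | ⟨hp, hβ2, rfl⟩
  · have hβp : β = p + q := by linear_combination q * hβ2 - (β - p) * hqβ
    have hpm : p ≤ m := by
      refine le_trans (Int.le_floor.2 ?_) hm
      linarith
    have hconj : (p : ℝ) - β = -q := by linarith
    obtain ⟨A, hA⟩ : ∃ A, A = m * β / (β ^ 2 - 1) := ⟨_, rfl⟩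
    have hden : 0 < β ^ 2 - 1 := by nlinarith
    have hA0 : 0 < A := by rw [hA]; positivity
    have hAm : β * A = m + q * A := by
      have : A * (β ^ 2 - 1) = m * β := by rw [hA]; field_simp
      linear_combination q * this + (m - β * A) * hqβ
    have hΩ : Set.Ioo (-((m : ℝ) * β) / (β ^ 2 - 1)) ((m : ℝ) * β ^ 2 / (β ^ 2 - 1)) =
        Set.Ioo (-A) (β * A) := by
      rw [hA]; congr 1 <;> ring
    rw [hΩ, hconj]
    have hqA : 0 < q * A := mul_pos hq0 hA0
    obtain ⟨N, -, hN⟩ := exists_forall_mem_Xspec_neg hp hβp hqβ hq0 hq1 hpm hA0 hAm k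
    obtain ⟨K, hK, hsub⟩ := Ici_inter_sigmaCP_subset_Xspec (β := β) (β' := -q) (M := β * A)
      (N := N) (m := m) (Ω := (fun x => (1 - δ) * x) '' Set.Ioo (-A) (β * A)) (by linarith)
      (by
        rintro _ ⟨w, ⟨-, hw⟩, rfl⟩
        have : 0 < β * A := by positivity
        dsimp only
        nlinarith)
      (by
        rintro a b hb ⟨w, ⟨hw1, hw2⟩, hw⟩
        have hw : a - b * q = (1 - δ) * w := by dsimp only at hw; linarith
        have h1 : δ * A ≤ a - b * q + A := by rw [hw]; nlinarith
        have h2 : δ * A ≤ β * A - (a - b * q) := by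
          have : δ * A ≤ δ * (β * A) := mul_le_mul_of_nonneg_left (by nlinarith) hδ0.le
          rw [hw]; nlinarith
        have h3 : A < β ^ k * (δ * A) := by nlinarith
        have hβk : 0 ≤ β ^ k := by positivity
        exact hN a b hb (h3.trans_le (mul_le_mul_of_nonneg_left h1 hβk))
          (h3.trans_le (mul_le_mul_of_nonneg_left h2 hβk)))
    refine ⟨K, hK, hsub, Xspec_subset_sigmaCP (p := p) (e := 1) (by simpa using hβ2) ?_ ?_ ?_⟩
    · push_cast
      linear_combination -q * hβp + hqβ
    · intro c hc
      have : (c : ℝ) ≤ m := by exact_mod_cast hc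
      have : (0 : ℝ) ≤ c := by positivity
      exact ⟨by linarith, by linarith⟩
    · rintro c hc y ⟨hy1, hy2⟩
      have : (c : ℝ) ≤ m := by exact_mod_cast hc
      have : (0 : ℝ) ≤ c := by positivity
      have h1 : q * y < A := by
        calc q * y < q * (β * A) := mul_lt_mul_of_pos_left hy2 hq0
          _ = A := by rw [← mul_assoc, hqβ, one_mul]
      have h2 : q * -A < q * y := mul_lt_mul_of_pos_left hy1 hq0
      exact ⟨by linarith, by linarith⟩
  · have hβp : β = p - q := by linear_combination q * hβ2 - (β - p) * hqβ
    have hconj : (p : ℝ) - β = q := by linarith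
    obtain ⟨L, hL⟩ : ∃ L, L = m * β / (β - 1) := ⟨_, rfl⟩
    have hden : 0 < β - 1 := by linarith
    have hL0 : 0 < L := by rw [hL]; positivity
    have hLm : β * L = β * m + L := by
      have : L * (β - 1) = m * β := by rw [hL]; field_simp
      linear_combination this
    have hqL : L = m + q * L := by
      linear_combination q * hLm + (m - L) * hqβ
    have hqL0 : 0 < q * L := mul_pos hq0 hL0
    rw [← hL, hconj]
    obtain ⟨N, -, hN⟩ := exists_forall_mem_Xspec_pos hβp hqβ hq0 hq1 hβm hL0 hLm k
    obtain ⟨K, hK, hsub⟩ := Ici_inter_sigmaCP_subset_Xspec (β := β) (β' := q) (M := L)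
      (N := N) (m := m) (Ω := (fun x => (1 - δ) * x) '' Set.Ico 0 L) (by linarith)
      (by
        rintro _ ⟨w, ⟨hw0, hw⟩, rfl⟩
        dsimp only
        nlinarith)
      (by
        rintro a b hb ⟨w, ⟨hw1, hw2⟩, hw⟩
        dsimp only at hw
        refine hN a b hb (hw ▸ mul_nonneg (by linarith) hw1) ?_
        have h1 : δ * L ≤ L - (a + b * q) := by rw [← hw]; nlinarith
        have h2 : L ≤ β ^ k * (δ * L) := by nlinarith
        exact h2.trans (mul_le_mul_of_nonneg_left h1 (by positivity)))
    refine ⟨K, hK, hsub, Xspec_subset_sigmaCP (p := p) (e := -1) ?_ ?_ ?_ ?_⟩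
    · push_cast
      linarith
    · push_cast
      linear_combination q * hβp - hqβ
    · intro c hc
      have : (c : ℝ) ≤ m := by exact_mod_cast hc
      exact ⟨by positivity, by linarith⟩
    · rintro c hc y ⟨hy1, hy2⟩
      have : (c : ℝ) ≤ m := by exact_mod_cast hc
      have h1 : q * y < q * L := mul_lt_mul_of_pos_left hy2 hq0
      exact ⟨by positivity, by linarith⟩
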